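/- arXiv:0904.1036 — 2 statements merged into one kernel-verified Lean document; each statement's English description precedes it below -/
import Mathlib

section
/- Let G: ℝ^N → ℝ^N be a homeomorphism such that ‖Ax − G(x)‖ ≤ r for all x ∈ ℝ^N. Then there exists a continuous surjection H: ℝ^N → ℝ^N such that A∘H = H∘G and ‖H(x) − x‖ ≤ r/(1−a) for all x ∈ ℝ^N; moreover H(x) is the unique point satisfying ‖A^n(H(x)) − G^n(x)‖ ≤ r/(1−a) for all n ∈ ℤ. -/
open MeasureTheory Filter Topology Set
open scoped ENNReal NNReal

namespace Samva

variable {X : Type*}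

/-- The `n`-th iterate (`n : ℤ`) of a homeomorphism. -/
noncomputable def zIter [TopologicalSpace X] (f : X ≃ₜ X) : ℤ → X → X
  | Int.ofNat n => (f : X → X)^[n]
  | Int.negSucc n => (f.symm : X → X)^[n + 1]

/-- `f` is expansive with expansivity constant `α`. -/
def IsExpansiveWith [PseudoMetricSpace X] (f : X ≃ₜ X) (α : ℝ) : Prop :=
  0 < α ∧ ∀ x y : X, (∀ n : ℤ, dist (zIter f n x) (zIter f n y) ≤ α) → x = y

/-- `f` is expansive. -/
def IsExpansive [PseudoMetricSpace X] (f : X ≃ₜ X) : Prop :=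
  ∃ α : ℝ, IsExpansiveWith f α

/-- The (periodic) specification property. -/
def HasSpecification [PseudoMetricSpace X] (f : X ≃ₜ X) : Prop :=
  ∀ ε : ℝ, 0 < ε → ∃ M : ℕ, ∀ (k : ℕ) (x : Fin (k + 1) → X) (a b : Fin (k + 1) → ℤ),
    (∀ i, a i ≤ b i) →
    (∀ i : Fin k, (M : ℤ) ≤ a i.succ - b i.castSucc) →
    ∀ p : ℤ, (M : ℤ) + b (Fin.last k) - a 0 ≤ p →
      ∃ z : X, zIter f p z = z ∧
        ∀ i, ∀ j : ℤ, a i ≤ j → j ≤ b i → dist (zIter f j z) (zIter f j (x i)) ≤ ε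

/-- The set of `n`-periodic points. -/
def perSet (f : X → X) (n : ℕ) : Set X := {x | f^[n] x = x}

/-- The uniform (equidistributed) probability measure on the `n`-periodic points of `f`,
`μ_n = |Per_n(f)|⁻¹ ∑_{x ∈ Per_n(f)} δ_x`. -/
noncomputable def perMeasure [MeasurableSpace X] (f : X → X) (n : ℕ) : Measure X :=
  ProbabilityTheory.uniformOn (perSet f n)

/-- The uniform probability measure on a set `s`,
`|s|⁻¹ ∑_{x ∈ s} δ_x`. -/
noncomputable def unifMeasure [MeasurableSpace X] (s : Set X) : Measure X :=
  ProbabilityTheory.uniformOn s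

/-- Weak* convergence of a sequence of measures against continuous test functions. -/
def WeakLimit [TopologicalSpace X] [MeasurableSpace X] (μs : ℕ → Measure X) (ν : Measure X) :
    Prop :=
  ∀ φ : C(X, ℝ), Tendsto (fun n => ∫ x, φ x ∂(μs n)) atTop (𝓝 (∫ x, φ x ∂ν))

/-- `ν` is a weak* accumulation point of the sequence `μs`. -/
def WeakClusterPt [TopologicalSpace X] [MeasurableSpace X] (μs : ℕ → Measure X)
    (ν : Measure X) : Prop :=
  ∃ u : ℕ → ℕ, StrictMono u ∧ WeakLimit (μs ∘ u) ν

/-- `E` is `(n,ε)`-separated for `g`. -/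
def IsSep [PseudoMetricSpace X] (g : X → X) (n : ℕ) (ε : ℝ) (E : Set X) : Prop :=
  E.Pairwise fun x y => ∃ j < n, ε < dist (g^[j] x) (g^[j] y)

/-- Maximal cardinality of an `(n,ε)`-separated subset of `K` for `g`. -/
noncomputable def sepCard [PseudoMetricSpace X] (g : X → X) (K : Set X) (n : ℕ) (ε : ℝ) :
    ℝ≥0∞ :=
  ⨆ (E : Finset X) (_ : ↑E ⊆ K ∧ IsSep g n ε ↑E), (E.card : ℝ≥0∞)

/-- Topological entropy of `g` relative to the set `K`:
`h_top(g,K) = lim_{ε→0} limsup_n (1/n) log E_K(n,ε)`; since the inner quantity is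
monotone in `ε`, the limit as `ε → 0` is the supremum over `ε > 0`. -/
noncomputable def relEntropy [PseudoMetricSpace X] (g : X → X) (K : Set X) : EReal :=
  ⨆ (ε : ℝ) (_ : 0 < ε),
    Filter.limsup (fun n : ℕ => ENNReal.log (sepCard g K n ε) / (n : EReal)) atTop

/-- Topological entropy of `g`. -/
noncomputable def topEntropy [PseudoMetricSpace X] (g : X → X) : EReal :=
  relEntropy g Set.univ

/-- A finite measurable partition of `X`. -/
def IsMPartition [MeasurableSpace X] (P : Finset (Set X)) : Prop :=
  (∀ A ∈ P, MeasurableSet A) ∧ ((P : Set (Set X)).PairwiseDisjoint id) ∧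
    ⋃₀ (P : Set (Set X)) = Set.univ

/-- The entropy `H_μ(P ∨ g⁻¹P ∨ ⋯ ∨ g^{-(n-1)}P)` of the `n`-th dynamical refinement of the
partition `P`. -/
noncomputable def dynH [MeasurableSpace X] (μ : Measure X) (g : X → X) (P : Finset (Set X))
    (n : ℕ) : ℝ :=
  ∑ A : Fin n → ↥P, Real.negMulLog (μ (⋂ i : Fin n, g^[i.1] ⁻¹' ((A i : Set X)))).toReal

/-- The measure-theoretic (Kolmogorov–Sinai) entropy `h_μ(g)`, using that for invariant `μ`
the limit `lim_n H_n/n` equals `inf_n H_n/n` by subadditivity. -/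
noncomputable def mEntropy [MeasurableSpace X] (g : X → X) (μ : Measure X) : EReal :=
  ⨆ P : {P : Finset (Set X) // IsMPartition P},
    ⨅ n : ℕ, ((dynH μ g (P : Finset (Set X)) (n + 1) / (n + 1) : ℝ) : EReal)

section Hyp

variable [MetricSpace X] [CompactSpace X] [MeasurableSpace X] [BorelSpace X]

/-- Hypothesis (H1): every class `[x] = h⁻¹(h x)` has zero relative topological entropy. -/
def HypH1 (g h : X → X) : Prop :=
  ∀ x : X, relEntropy g (h ⁻¹' {h x}) = 0

/-- Hypothesis (H2): every periodic class contains a `g`-periodic point whose `g`-period is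
the `f`-period of `h x`. -/
def HypH2 (f g h : X → X) : Prop :=
  ∀ x : X, h x ∈ Function.periodicPts f →
    ∃ y : X, h y = h x ∧ Function.minimalPeriod g y = Function.minimalPeriod f (h x)

/-- Hypothesis (H3): the set of points whose class is trivial has full Bowen measure. -/
def HypH3 (h : X → X) (μ : Measure X) : Prop :=
  μ {y : X | ∃ x : X, h ⁻¹' {y} = {x}} = 1

/-- `P` is an admissible choice of the sets `P̃er_n(g)`: `P n` consists of `g`-periodic points
of period `n` lying over `Per_n(f)`, and `h` maps `P n` bijectively onto `Per_n(f)`. -/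
def IsPerSelection (f g h : X → X) (P : ℕ → Set X) : Prop :=
  ∀ n : ℕ, P n ⊆ perSet g n ∧ (∀ x ∈ P n, g x ∈ P n) ∧ Set.BijOn h (P n) (perSet f n)

end Hyp

end Samva

open Samva

/-- `det (1 + t M)` at `t = 1` is determined by Lagrange interpolation from `n + 1` nodes. -/
theorem det_interp {E : Type*} [NormedAddCommGroup E] [NormedSpace ℝ E] [FiniteDimensional ℝ E]
    (s : Finset ℝ) (hs : Module.finrank ℝ E < s.card) (M : E →L[ℝ] E) :
    (1 + M : E →L[ℝ] E).det =
      ∑ t ∈ s, (1 + t • M : E →L[ℝ] E).det * (Lagrange.basis s id t).eval 1 := by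
  let b := Module.finBasis ℝ E
  let m := LinearMap.toMatrix b b (M : E →ₗ[ℝ] E)
  let P : Polynomial ℝ := Matrix.det ((Polynomial.X : Polynomial ℝ) • m.map Polynomial.C
    + (1 : Matrix _ _ ℝ).map Polynomial.C)
  have hP : ∀ t : ℝ, P.eval t = (1 + t • M : E →L[ℝ] E).det := by
    intro t
    have h1 : (1 + t • M : E →L[ℝ] E).det = Matrix.det (t • m + 1) := by
      rw [ContinuousLinearMap.det, ← LinearMap.det_toMatrix b]
      congr 1
      have : ((1 + t • M : E →L[ℝ] E) : E →ₗ[ℝ] E) = t • (M : E →ₗ[ℝ] E) + 1 := by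
        ext x; simp [add_comm]
      rw [this, map_add, map_smul, LinearMap.toMatrix_one]
    rw [h1, ← Polynomial.coe_evalRingHom, RingHom.map_det]
    congr 1
    ext i j
    by_cases hij : i = j <;> simp [Matrix.map_apply, hij] <;> ring
  have hdeg : P.degree < s.card := by
    refine Polynomial.degree_le_natDegree.trans_lt ?_
    have := Polynomial.natDegree_det_X_add_C_le m 1
    rw [Fintype.card_fin] at this
    exact_mod_cast this.trans_lt hs
  have := congrArg (Polynomial.eval 1) (Lagrange.eq_interpolate (v := id) (injOn_id _) hdeg)
  rw [hP, Lagrange.interpolate_apply, Polynomial.eval_finsetSum] at this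
  simpa [hP] using this

theorem no_retraction {E : Type*} [NormedAddCommGroup E] [InnerProductSpace ℝ E]
    [FiniteDimensional ℝ E] (R : ℝ) (hR : 0 < R) (ρ : E → E) (hρ : ContDiff ℝ 1 ρ)
    (h1 : ∀ x, ‖ρ x‖ = R) (h2 : ∀ x, ‖x‖ = R → ρ x = x) : False := by
  borelize E
  let k : E → E := fun x => ρ x - x
  have hk : ContDiff ℝ 1 k := hρ.sub contDiff_id
  have hkd : Differentiable ℝ k := hk.differentiable (by norm_num)
  have hkc : Continuous (fderiv ℝ k) := hk.continuous_fderiv (by norm_num)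
  -- bound of the derivative
  obtain ⟨L, hL⟩ : ∃ L : ℝ≥0, ∀ x ∈ Metric.closedBall (0:E) R, ‖fderiv ℝ k x‖₊ ≤ L := by
    obtain ⟨C, hC⟩ := (isCompact_closedBall (0:E) R).exists_bound_of_continuousOn hkc.continuousOn
    refine ⟨C.toNNReal, fun x hx => ?_⟩
    rw [← NNReal.coe_le_coe]
    exact (hC x hx).trans (Real.le_coe_toNNReal C)
  have hlip : LipschitzOnWith L k (Metric.closedBall (0:E) R) :=
    (convex_closedBall _ _).lipschitzOnWith_of_nnnorm_fderiv_le (fun x _ => hkd x) hL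
  -- extension by zero
  classical
  let K : E → E := fun x => if ‖x‖ ≤ R then k x else 0
  have hk0 : ∀ x, ‖x‖ = R → k x = 0 := fun x hx => by simp [k, h2 x hx]
  have hmix : ∀ x y : E, ‖x‖ ≤ R → R < ‖y‖ → ‖k x‖ ≤ L * ‖x - y‖ := by
    intro x y hx hy
    obtain ⟨z, hz, hzR⟩ : ∃ z ∈ segment ℝ x y, ‖z‖ = R := by
      have := (convex_segment (𝕜 := ℝ) x y).isPreconnected.intermediate_value
        (left_mem_segment ℝ x y) (right_mem_segment ℝ x y) (continuous_norm.continuousOn)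
      exact this ⟨hx, hy.le⟩
    have hd := hlip.dist_le_mul x (by simpa using hx) z (by simp [hzR])
    rw [hk0 z hzR, dist_zero_right] at hd
    have h3 := dist_add_dist_of_mem_segment hz
    have h4 : dist x z ≤ ‖x - y‖ := by
      rw [← dist_eq_norm]; linarith [dist_nonneg (x := z) (y := y)]
    exact hd.trans (by gcongr)
  have hK : LipschitzWith L K := by
    apply LipschitzWith.of_dist_le_mul
    intro x y
    rw [dist_eq_norm, dist_eq_norm]
    by_cases hx : ‖x‖ ≤ R <;> by_cases hy : ‖y‖ ≤ R
    · simp only [K, hx, hy, if_true]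
      have := hlip.dist_le_mul x (by simpa using hx) y (by simpa using hy)
      simpa [dist_eq_norm] using this
    · simp only [K, hx, hy, if_true, if_false, sub_zero]
      exact hmix x y hx (not_le.1 hy)
    · simp only [K, hx, hy, if_true, if_false, zero_sub, norm_neg]
      rw [norm_sub_rev x y]
      exact hmix y x hy (not_le.1 hx)
    · simp [K, hx, hy]; positivity
  -- small perturbations of the identity have positive determinant
  obtain ⟨ε, hε, hdet⟩ : ∃ ε > 0, ∀ M : E →L[ℝ] E, ‖M‖ < ε → 0 < (1 + M : E →L[ℝ] E).det := by
    have hc : Continuous fun M : E →L[ℝ] E => (1 + M : E →L[ℝ] E).det :=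
      ContinuousLinearMap.continuous_det.comp (continuous_const.add continuous_id)
    have h0 : (0:ℝ) < (1 + (0 : E →L[ℝ] E) : E →L[ℝ] E).det := by
      simp [ContinuousLinearMap.det]
    have := (hc.tendsto 0).eventually (lt_mem_nhds h0)
    obtain ⟨ε, hε, h⟩ := Metric.eventually_nhds_iff.1 this
    exact ⟨ε, hε, fun M hM => h (by simpa using hM)⟩
  let t0 : ℝ := min ε 1 / (L + 1)
  have hL1 : (0:ℝ) < L + 1 := by positivity
  have ht0 : 0 < t0 := by positivity
  have key : ∀ t ∈ Ioo 0 t0,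
      ∫ x in Metric.ball (0:E) R, (1 + t • fderiv ℝ k x : E →L[ℝ] E).det
        = (volume (Metric.ball (0:E) R)).toReal := by
    intro t ht
    have htL : t * (L + 1) < min ε 1 := by
      have := ht.2
      rwa [lt_div_iff₀ hL1] at this
    have htL1 : t * L < 1 := by
      have := min_le_right ε 1
      nlinarith [ht.1]
    have htLε : t * L < ε := by
      have := min_le_left ε 1
      nlinarith [ht.1]
    let f : E → E := fun x => x + t • K x
    have hcon : ∀ y, ContractingWith (t.toNNReal * L) (fun x => y - t • K x) := by
      intro y
      refine ⟨by rw [← NNReal.coe_lt_coe]; simpa [Real.coe_toNNReal t ht.1.le] using htL1, ?_⟩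
      apply LipschitzWith.of_dist_le_mul
      intro u v
      have := hK.dist_le_mul u v
      simp only [dist_sub_left, dist_smul₀, NNReal.coe_mul, Real.coe_toNNReal t ht.1.le, Real.norm_eq_abs,
        abs_of_pos ht.1]
      rw [mul_assoc]
      exact mul_le_mul_of_nonneg_left this ht.1.le
    have hinj : Function.Injective f := by
      intro u v huv
      have hu : Function.IsFixedPt (fun x => f u - t • K x) u := by
        simp [Function.IsFixedPt, f]
      have hv : Function.IsFixedPt (fun x => f u - t • K x) v := by
        rw [huv]; simp [Function.IsFixedPt, f]
      exact (hcon (f u)).fixedPoint_unique' hu hv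
    have hsurj : Function.Surjective f := by
      intro y
      have := (hcon y).fixedPoint_isFixedPt
      exact ⟨_, eq_sub_iff_add_eq.1 this.symm⟩
    have hout : ∀ x, R ≤ ‖x‖ → f x = x := by
      intro x hx
      have : K x = 0 := by
        by_cases h : ‖x‖ ≤ R
        · simp [K, h, hk0 x (le_antisymm h hx)]
        · simp [K, h]
      simp [f, this]
    have himg : f '' Metric.ball (0:E) R = Metric.ball (0:E) R := by
      ext y
      simp only [mem_image, mem_ball_zero_iff]
      constructor
      · rintro ⟨x, hx, rfl⟩
        by_contra h
        have h' := hinj (hout _ (not_lt.1 h))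
        rw [h'] at h
        exact h hx
      · intro hy
        obtain ⟨x, rfl⟩ := hsurj y
        refine ⟨x, ?_, rfl⟩
        by_contra h
        rw [hout x (not_lt.1 h)] at hy
        exact h hy
    have hder : ∀ x ∈ Metric.ball (0:E) R,
        HasFDerivWithinAt f (1 + t • fderiv ℝ k x) (Metric.ball (0:E) R) x := by
      intro x hx
      have h3 : HasFDerivAt (fun x => x + t • k x) (1 + t • fderiv ℝ k x) x :=
        (hasFDerivAt_id x).add ((hkd x).hasFDerivAt.const_smul t)
      refine h3.hasFDerivWithinAt.congr (fun z hz => ?_) ?_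
      · have : ‖z‖ ≤ R := by simpa using (Metric.ball_subset_closedBall hz)
        simp [f, K, this]
      · have : ‖x‖ ≤ R := by simpa using (Metric.ball_subset_closedBall hx)
        simp [f, K, this]
    have hcv := integral_image_eq_integral_abs_det_fderiv_smul volume
      (Metric.isOpen_ball.measurableSet) hder hinj.injOn (fun _ => (1:ℝ))
    rw [himg] at hcv
    simp only [smul_eq_mul, mul_one, integral_const, MeasurableSet.univ, measureReal_restrict_apply,
      univ_inter] at hcv
    change _ = volume.real _
    rw [hcv]
    refine setIntegral_congr_fun Metric.isOpen_ball.measurableSet (fun x hx => ?_)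
    have : 0 < (1 + t • fderiv ℝ k x : E →L[ℝ] E).det := by
      apply hdet
      rw [norm_smul, Real.norm_eq_abs, abs_of_pos ht.1]
      have : ‖fderiv ℝ k x‖ ≤ L := hL x (Metric.ball_subset_closedBall hx)
      exact (mul_le_mul_of_nonneg_left this ht.1.le).trans_lt htLε
    simp [abs_of_pos this]
  have hzero : ∀ x, (1 + fderiv ℝ k x : E →L[ℝ] E).det = 0 := by
    intro x
    have hρd : Differentiable ℝ ρ := hρ.differentiable (by norm_num)
    have h3 : (1 + fderiv ℝ k x : E →L[ℝ] E) = fderiv ℝ ρ x := by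
      have : HasFDerivAt k (fderiv ℝ ρ x - 1) x := (hρd x).hasFDerivAt.sub (hasFDerivAt_id x)
      rw [this.fderiv]; abel
    rw [h3]
    by_contra hne
    have horth : ∀ v, inner ℝ (ρ x) (fderiv ℝ ρ x v) = 0 := by
      intro v
      have h4 := (hρd x).hasFDerivAt.norm_sq
      have h5 : (fun x => ‖ρ x‖ ^ 2) = fun _ => R ^ 2 := by ext; rw [h1]
      rw [h5] at h4
      have h6 := congrArg (fun T : E →L[ℝ] ℝ => T v) (h4.unique (hasFDerivAt_const _ x))
      simpa using h6
    have hsur : Function.Surjective (fderiv ℝ ρ x) := by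
      have := LinearMap.range_eq_top.1 (LinearMap.range_eq_top.2 (LinearEquiv.ofIsUnitDet
        (f := (fderiv ℝ ρ x : E →ₗ[ℝ] E)) (v := Module.finBasis ℝ E) (v' := Module.finBasis ℝ E)
          (by rw [LinearMap.det_toMatrix]; exact isUnit_iff_ne_zero.2 hne)).surjective)
      exact this
    obtain ⟨v, hv⟩ := hsur (ρ x)
    have := horth v
    rw [hv, real_inner_self_eq_norm_sq, h1] at this
    exact hR.ne' (by simpa using this)
  obtain ⟨s, hsub, hcard⟩ := (Ioo_infinite ht0).exists_subset_card_eq (Module.finrank ℝ E + 1)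
  have hint : ∀ t : ℝ, IntegrableOn (fun x => (1 + t • fderiv ℝ k x : E →L[ℝ] E).det)
      (Metric.ball (0:E) R) := by
    intro t
    have : Continuous (fun x => (1 + t • fderiv ℝ k x : E →L[ℝ] E).det) :=
      ContinuousLinearMap.continuous_det.comp (continuous_const.add (hkc.const_smul t))
    exact (this.continuousOn.integrableOn_compact (isCompact_closedBall 0 R)).mono_set
      Metric.ball_subset_closedBall
  have hfin : ∫ x in Metric.ball (0:E) R, (1 + fderiv ℝ k x : E →L[ℝ] E).det
      = (volume (Metric.ball (0:E) R)).toReal := by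
    simp_rw [det_interp s (by omega) (fderiv ℝ k _)]
    rw [integral_finsetSum _ (fun t _ => (hint t).mul_const _)]
    simp_rw [integral_mul_const]
    rw [Finset.sum_congr rfl (fun t ht => by rw [key t (hsub ht)]), ← Finset.mul_sum,
      ← Polynomial.eval_finsetSum, Lagrange.sum_basis (injOn_id _)
        (Finset.card_pos.1 (by omega))]
    simp
  simp only [hzero, integral_zero] at hfin
  have hpos : 0 < (volume (Metric.ball (0:E) R)).toReal :=
    ENNReal.toReal_pos (Metric.measure_ball_pos volume 0 hR).ne' measure_ball_lt_top.ne
  linarith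

/-- A continuous map at bounded distance from the identity has a zero (Euclidean case). -/
theorem exists_zero_of_near_id {E : Type*} [NormedAddCommGroup E] [InnerProductSpace ℝ E]
    [FiniteDimensional ℝ E] (F : E → E) (hF : Continuous F) (C : ℝ)
    (hC : ∀ x, ‖F x - x‖ ≤ C) : ∃ x, F x = 0 := by
  by_contra! hne
  have hC0 : 0 ≤ C := (norm_nonneg _).trans (hC 0)
  obtain ⟨δ, hδ, hδF⟩ : ∃ δ > 0, ∀ x ∈ Metric.closedBall (0:E) (C + 3), δ ≤ ‖F x‖ := by
    obtain ⟨x0, -, hx0⟩ := (isCompact_closedBall (0:E) (C + 3)).exists_isMinOn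
      ⟨0, by simp; linarith⟩ hF.norm.continuousOn
    exact ⟨‖F x0‖, norm_pos_iff.2 (hne x0), fun x hx => hx0 hx⟩
  obtain ⟨g, hg, hgF, -⟩ := (hF.sub continuous_id).exists_contDiff_approx 1
    (ε := fun _ => min δ 1) continuous_const (fun _ => by positivity)
  let χ : ContDiffBump (0:E) := ⟨C + 2, C + 3, by linarith, by linarith⟩
  let F1 : E → E := fun x => x + χ x • g x
  have hF1 : ContDiff ℝ 1 F1 := contDiff_id.add (χ.contDiff.smul hg)
  have hF1ne : ∀ x, F1 x ≠ 0 := by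
    intro x hx
    have hgx : ‖g x - (F x - x)‖ < min δ 1 := by simpa [dist_eq_norm] using hgF x
    by_cases hxb : ‖x‖ ≤ C + 2
    · have h1 : χ x = 1 := χ.one_of_mem_closedBall (by simpa using hxb)
      simp only [F1, h1, one_smul] at hx
      have h2 : g x - (F x - x) = - F x := by
        rw [eq_neg_iff_add_eq_zero, ← hx]; abel
      rw [h2, norm_neg] at hgx
      have := hδF x (by simp; linarith)
      exact absurd hgx (not_lt.2 ((min_le_left _ _).trans this))
    · push Not at hxb
      have h2 : ‖g x‖ < C + 1 := by
        have h3 : g x = (g x - (F x - x)) + (F x - x) := by abel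
        rw [h3]
        have := min_le_right δ 1
        linarith [norm_add_le (g x - (F x - x)) (F x - x), hC x]
      have h4 : x = - (χ x • g x) := eq_neg_of_add_eq_zero_left hx
      have h5 : ‖x‖ ≤ ‖g x‖ := by
        conv_lhs => rw [h4]
        rw [norm_neg, norm_smul, Real.norm_eq_abs, abs_of_nonneg χ.nonneg]
        exact mul_le_of_le_one_left (norm_nonneg _) χ.le_one
      linarith
  have hR : (0:ℝ) < C + 3 := by linarith
  refine no_retraction (C + 3) hR (fun x => ((C + 3) / ‖F1 x‖) • F1 x) ?_ ?_ ?_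
  · exact (contDiff_const.div (hF1.norm ℝ hF1ne) (fun x => norm_ne_zero_iff.2 (hF1ne x))).smul hF1
  · intro x
    rw [norm_smul, norm_div, norm_norm, Real.norm_eq_abs, abs_of_pos hR,
      div_mul_cancel₀ _ (norm_ne_zero_iff.2 (hF1ne x))]
  · intro x hx
    have h1 : χ x = 0 := χ.zero_of_le_dist (by simp [hx, χ])
    have h2 : F1 x = x := by simp [F1, h1]
    simp only [h2, hx, div_self hR.ne', one_smul]

/-- A continuous self-map of a finite dimensional space at bounded distance from the identity is
surjective. -/
theorem surjective_of_near_id {V : Type*} [NormedAddCommGroup V] [NormedSpace ℝ V]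
    [FiniteDimensional ℝ V] (H : V → V) (hH : Continuous H) (C : ℝ)
    (hC : ∀ x, ‖H x - x‖ ≤ C) : Function.Surjective H := by
  intro y
  let e := toEuclidean (E := V)
  have hC0 : 0 ≤ C := (norm_nonneg _).trans (hC 0)
  obtain ⟨x, hx⟩ := exists_zero_of_near_id (fun z => e (H (e.symm z) - y))
    (e.continuous.comp ((hH.comp e.symm.continuous).sub continuous_const))
    (‖(e : V →L[ℝ] EuclideanSpace ℝ (Fin (Module.finrank ℝ V)))‖ * (C + ‖y‖)) (by
      intro z
      have h1 : e (H (e.symm z) - y) - z = (e : V →L[ℝ] EuclideanSpace ℝ (Fin (Module.finrank ℝ V))) (H (e.symm z) - e.symm z - y) := by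
        simp [map_sub]; abel
      rw [h1]
      have h2 : ‖H (e.symm z) - e.symm z - y‖ ≤ C + ‖y‖ :=
        (norm_sub_le _ _).trans (add_le_add (hC _) le_rfl)
      exact (ContinuousLinearMap.le_opNorm _ _).trans
        (mul_le_mul_of_nonneg_left h2 (norm_nonneg _)))
  refine ⟨e.symm x, ?_⟩
  have := e.map_eq_zero_iff.1 hx
  exact sub_eq_zero.1 this

/-- Any homeomorphism `G` at `C⁰`-distance at most `r` from the hyperbolic linear
isomorphism `A` is semiconjugate to `A` by a continuous surjection `H` with
`‖H(x) − x‖ ≤ r/(1−a)`, where `H(x)` is the unique point shadowing the `G`-orbit of `x`. -/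
theorem semiconjugacy_of_perturbation
    {V : Type*} [NormedAddCommGroup V] [NormedSpace ℝ V] [FiniteDimensional ℝ V]
    (A : V ≃L[ℝ] V) (Ps Pu : V →L[ℝ] V) (a : ℝ) (ha0 : 0 < a) (ha1 : a < 1)
    (hPs : ∀ x : V, Ps (Ps x) = Ps x) (hPu : ∀ x : V, Pu (Pu x) = Pu x)
    (hsum : ∀ x : V, Ps x + Pu x = x)
    (hAPs : ∀ x : V, A (Ps x) = Ps (A x)) (hAPu : ∀ x : V, A (Pu x) = Pu (A x))
    (hnorm : ∀ x : V, ‖x‖ = max ‖Ps x‖ ‖Pu x‖)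
    (hcontr : ∀ x : V, ‖A (Ps x)‖ ≤ a * ‖Ps x‖)
    (hexpd : ∀ x : V, ‖A.symm (Pu x)‖ ≤ a * ‖Pu x‖)
    (r : ℝ) (hr : 0 < r) (G : V ≃ₜ V) (hG : ∀ x : V, ‖A x - G x‖ ≤ r) :
    ∃ H : V → V, Continuous H ∧ Function.Surjective H ∧
      (∀ x : V, A (H x) = H (G x)) ∧
      (∀ x : V, ‖H x - x‖ ≤ r / (1 - a)) ∧
      (∀ x y : V, (∀ n : ℤ, ‖(A ^ n) y - zIter G n x‖ ≤ r / (1 - a)) → y = H x) := by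
  have hPuPs : ∀ x, Pu (Ps x) = 0 := fun x => by
    have := hsum (Ps x); rw [hPs] at this; simpa using this
  have hPsPu : ∀ x, Ps (Pu x) = 0 := fun x => by
    have := hsum (Pu x); rw [hPu] at this; simpa using this
  have hnPs : ∀ x, ‖Ps x‖ ≤ ‖x‖ := fun x => by rw [hnorm x]; exact le_max_left _ _
  have hnPu : ∀ x, ‖Pu x‖ ≤ ‖x‖ := fun x => by rw [hnorm x]; exact le_max_right _ _
  have hBPu : ∀ x, A.symm (Pu x) = Pu (A.symm x) := fun x => by
    rw [A.symm_apply_eq, hAPu, A.apply_symm_apply]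
  have hAs : ∀ (n : ℕ) x, A^[n] (Ps x) = Ps (A^[n] x) := by
    intro n x
    induction n with
    | zero => rfl
    | succ n ih => rw [Function.iterate_succ_apply', ih, hAPs, Function.iterate_succ_apply']
  have hBu : ∀ (n : ℕ) x, A.symm^[n] (Pu x) = Pu (A.symm^[n] x) := by
    intro n x
    induction n with
    | zero => rfl
    | succ n ih => rw [Function.iterate_succ_apply', ih, hBPu, Function.iterate_succ_apply']
  have hAsn : ∀ (n : ℕ) x, ‖A^[n] (Ps x)‖ ≤ a ^ n * ‖Ps x‖ := by
    intro n x
    induction n with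
    | zero => simp
    | succ n ih =>
      rw [Function.iterate_succ_apply', hAs, pow_succ']
      refine (hcontr _).trans ?_
      rw [← hAs, mul_assoc]
      gcongr
  have hBun : ∀ (n : ℕ) x, ‖A.symm^[n] (Pu x)‖ ≤ a ^ n * ‖Pu x‖ := by
    intro n x
    induction n with
    | zero => simp
    | succ n ih =>
      rw [Function.iterate_succ_apply', hBu, pow_succ']
      refine (hexpd _).trans ?_
      rw [← hBu, mul_assoc]
      gcongr
  have hAic : ∀ n : ℕ, Continuous (A^[n]) := fun n => A.continuous.iterate n
  have hBic : ∀ n : ℕ, Continuous (A.symm^[n]) := fun n => A.symm.continuous.iterate n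
  -- the perturbation
  let p : V → V := fun x => G x - A x
  have hp : ∀ x, ‖p x‖ ≤ r := fun x => by rw [norm_sub_rev]; exact hG x
  have hpc : Continuous p := G.continuous.sub A.continuous
  let ts : ℕ → V → V := fun n z => A^[n] (Ps (p (G.symm^[n+1] z)))
  let tu : ℕ → V → V := fun n z => A.symm^[n+1] (Pu (p (G^[n] z)))
  have hgeo : Summable fun n : ℕ => a ^ n * r :=
    (summable_geometric_of_lt_one ha0.le ha1).mul_right r
  have hgs : ∑' n : ℕ, a ^ n * r = r / (1 - a) := by
    rw [tsum_mul_right, tsum_geometric_of_lt_one ha0.le ha1]; field_simp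
  have hts : ∀ n z, ‖ts n z‖ ≤ a ^ n * r := fun n z =>
    (hAsn n _).trans (by gcongr; exact (hnPs _).trans (hp _))
  have htu : ∀ n z, ‖tu n z‖ ≤ a ^ n * r := fun n z =>
    (hBun (n+1) _).trans (by
      have h1 : a ^ (n+1) ≤ a ^ n := pow_le_pow_of_le_one ha0.le ha1.le (Nat.le_succ n)
      have h2 : ‖Pu (p (G^[n] z))‖ ≤ r := (hnPu _).trans (hp _)
      gcongr)
  have htsc : ∀ n, Continuous (ts n) := fun n =>
    (hAic n).comp (Ps.continuous.comp (hpc.comp (G.symm.continuous.iterate (n+1))))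
  have htuc : ∀ n, Continuous (tu n) := fun n =>
    (hBic (n+1)).comp (Pu.continuous.comp (hpc.comp (G.continuous.iterate n)))
  let hs : V → V := fun z => ∑' n, ts n z
  let hu : V → V := fun z => ∑' n, tu n z
  have hsS : ∀ z, Summable fun n => ts n z := fun z => hgeo.of_norm_bounded (fun n => hts n z)
  have huS : ∀ z, Summable fun n => tu n z := fun z => hgeo.of_norm_bounded (fun n => htu n z)
  have hsc : Continuous hs := continuous_tsum htsc hgeo hts
  have huc : Continuous hu := continuous_tsum htuc hgeo htu
  have hsn : ∀ z, ‖hs z‖ ≤ r / (1 - a) := fun z => by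
    rw [← hgs]; exact tsum_of_norm_bounded hgeo.hasSum (fun n => hts n z)
  have hun : ∀ z, ‖hu z‖ ≤ r / (1 - a) := fun z => by
    rw [← hgs]; exact tsum_of_norm_bounded hgeo.hasSum (fun n => htu n z)
  have hPshs : ∀ z, Ps (hs z) = hs z := fun z => by
    simp only [hs]; rw [Ps.map_tsum (hsS z)]
    exact tsum_congr fun n => by simp only [ts]; rw [hAs, hPs]
  have hPuhu : ∀ z, Pu (hu z) = hu z := fun z => by
    simp only [hu]; rw [Pu.map_tsum (huS z)]
    exact tsum_congr fun n => by simp only [tu]; rw [hBu, hPu]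
  have hPuhs : ∀ z, Pu (hs z) = 0 := fun z => by rw [← hPshs, hPuPs]
  have hPshu : ∀ z, Ps (hu z) = 0 := fun z => by rw [← hPuhu, hPsPu]
  have hseq : ∀ x, hs (G x) = Ps (p x) + A (hs x) := by
    intro x
    simp only [hs]
    rw [(hsS (G x)).tsum_eq_zero_add, A.map_tsum]
    congr 1
    · simp [ts]
    · refine tsum_congr fun n => ?_
      simp only [ts]
      rw [Function.iterate_succ_apply' (⇑A), Function.iterate_succ_apply (⇑G.symm) (n+1),
        G.symm_apply_apply]
  have hueq : ∀ x, A (hu x) = Pu (p x) + hu (G x) := by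
    intro x
    simp only [hu]
    rw [(huS x).tsum_eq_zero_add, map_add, A.map_tsum]
    congr 1
    · simp [tu]
    · refine tsum_congr fun n => ?_
      simp only [tu]
      rw [Function.iterate_succ_apply' (⇑A.symm), A.apply_symm_apply,
        Function.iterate_succ_apply (⇑G)]
  let H : V → V := fun x => x + (hu x - hs x)
  have hHc : Continuous H := continuous_id.add (huc.sub hsc)
  have hHn : ∀ x, ‖H x - x‖ ≤ r / (1 - a) := by
    intro x
    have h1 : H x - x = hu x - hs x := by simp [H]
    rw [h1, hnorm, map_sub, map_sub, hPshu, hPuhu, hPshs, hPuhs, zero_sub, sub_zero, norm_neg]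
    exact max_le (hsn x) (hun x)
  have hHA : ∀ x, A (H x) = H (G x) := by
    intro x
    simp only [H, map_add, map_sub]
    rw [hueq, hseq]
    have h1 : G x = A x + (Ps (p x) + Pu (p x)) := by rw [hsum]; simp [p]
    conv_rhs => rw [show ∀ w, G x + w = A x + (Ps (p x) + Pu (p x)) + w from fun w => by rw [← h1]]
    abel
  refine ⟨H, hHc, surjective_of_near_id H hHc _ hHn, hHA, hHn, ?_⟩
  intro x y hxy
  have hApow : ∀ (n : ℕ) v, (A ^ (n:ℤ)) v = A^[n] v := by
    intro n v
    rw [zpow_natCast]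
    induction n with
    | zero => rfl
    | succ n ih => rw [pow_succ', Function.iterate_succ_apply', ← ih]; rfl
  have hAneg : ∀ (n : ℕ) v, (A ^ (-(n:ℤ))) v = A.symm^[n] v := by
    intro n v
    rw [zpow_neg, zpow_natCast, ← inv_pow]
    induction n with
    | zero => rfl
    | succ n ih => rw [pow_succ', Function.iterate_succ_apply', ← ih]; rfl
  have hGneg : ∀ (n : ℕ) v, zIter G (-(n:ℤ)) v = G.symm^[n] v := by
    intro n v
    cases n with
    | zero => rfl
    | succ n => rfl
  have hHB : ∀ x, A.symm (H x) = H (G.symm x) := fun x => by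
    rw [A.symm_apply_eq, hHA, G.apply_symm_apply]
  have hHAn : ∀ (n : ℕ) v, A^[n] (H v) = H (G^[n] v) := fun n v =>
    ((Function.Semiconj.iterate_right (f := H) (ga := G) (gb := A) (fun v => (hHA v).symm) n) v).symm
  have hHBn : ∀ (n : ℕ) v, A.symm^[n] (H v) = H (G.symm^[n] v) := fun n v =>
    ((Function.Semiconj.iterate_right (f := H) (ga := G.symm) (gb := A.symm)
      (fun v => (hHB v).symm) n) v).symm
  set C := r / (1 - a) with hCdef
  have hAsub : ∀ (n : ℕ) u v, A^[n] (u - v) = A^[n] u - A^[n] v := fun n u v => by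
    rw [← hApow, map_sub, hApow, hApow]
  have hBsub : ∀ (n : ℕ) u v, A.symm^[n] (u - v) = A.symm^[n] u - A.symm^[n] v := fun n u v => by
    rw [← hAneg, map_sub, hAneg, hAneg]
  have hb1 : ∀ n : ℕ, ‖A^[n] (y - H x)‖ ≤ C + C := by
    intro n
    have h1 := hxy n
    rw [hApow] at h1
    have h2 := hHn (G^[n] x)
    rw [norm_sub_rev] at h2
    rw [hAsub, hHAn]
    refine le_trans ?_ (add_le_add h1 h2)
    refine le_trans (le_of_eq ?_) (norm_add_le _ _)
    congr 1
    change _ = A^[n] y - G^[n] x + _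
    abel
  have hb2 : ∀ n : ℕ, ‖A.symm^[n] (y - H x)‖ ≤ C + C := by
    intro n
    have h1 := hxy (-(n:ℤ))
    rw [hAneg, hGneg] at h1
    have h2 := hHn (G.symm^[n] x)
    rw [norm_sub_rev] at h2
    rw [hBsub, hHBn]
    refine le_trans ?_ (add_le_add h1 h2)
    refine le_trans (le_of_eq ?_) (norm_add_le _ _)
    congr 1
    abel
  have hlim : Tendsto (fun n : ℕ => a ^ n * (C + C)) atTop (𝓝 0) := by
    simpa using (tendsto_pow_atTop_nhds_zero_of_lt_one ha0.le ha1).mul_const (C + C)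
  have hAB : ∀ (n : ℕ) v, A^[n] (A.symm^[n] v) = v := fun n v =>
    (Function.LeftInverse.iterate (f := A.symm) (g := A) A.apply_symm_apply n) v
  have hBA : ∀ (n : ℕ) v, A.symm^[n] (A^[n] v) = v := fun n v =>
    (Function.LeftInverse.iterate (f := A) (g := A.symm) A.symm_apply_apply n) v
  have hw1 : Ps (y - H x) = 0 := by
    rw [← norm_le_zero_iff]
    refine ge_of_tendsto' hlim fun n => ?_
    conv_lhs => rw [← hAB n (y - H x), ← hAs]
    refine (hAsn n _).trans ?_
    gcongr
    exact (hnPs _).trans (hb2 n)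
  have hw2 : Pu (y - H x) = 0 := by
    rw [← norm_le_zero_iff]
    refine ge_of_tendsto' hlim fun n => ?_
    conv_lhs => rw [← hBA n (y - H x), ← hBu]
    refine (hBun n _).trans ?_
    gcongr
    exact (hnPu _).trans (hb1 n)
  have := hsum (y - H x)
  rw [hw1, hw2, add_zero] at this
  exact sub_eq_zero.1 this.symm
end

section
/- Let G: ℝ^N → ℝ^N be a homeomorphism with ‖Ax − G(x)‖ ≤ r for all x, of the form G = A + p where p: ℝ^N → ℝ^N is ℤ^N-periodic (p(x+t) = p(x) for all t ∈ ℤ^N), and let H: ℝ^N → ℝ^N be the map determined by ‖A^n(H(x)) − G^n(x)‖ ≤ r/(1−a) for all n ∈ ℤ. Then H(x + t) = H(x) + t for every x ∈ ℝ^N and every t ∈ ℤ^N; in particular H descends to a continuous surjection of the torus ℝ^N/ℤ^N. -/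
open MeasureTheory Filter Topology Set
open scoped ENNReal NNReal

open Samva


/-- Interpolation coefficients for the polynomial `t ↦ det (1 + t T)`. -/
theorem det_interp_s11 (n : ℕ) (τ : Fin (n + 1) → ℝ) (hτ : Function.Injective τ) :
    ∃ c : Fin (n + 1) → ℝ, (∑ i, c i = 1) ∧
      ∀ T : EuclideanSpace ℝ (Fin n) →L[ℝ] EuclideanSpace ℝ (Fin n),
        (ContinuousLinearMap.id ℝ _ + T).det =
          ∑ i, c i * (ContinuousLinearMap.id ℝ _ + τ i • T).det := by
  classical
  refine ⟨fun i => (Lagrange.basis Finset.univ τ i).eval 1, ?_, ?_⟩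
  · rw [← Polynomial.eval_finsetSum, Lagrange.sum_basis hτ.injOn Finset.univ_nonempty,
      Polynomial.eval_one]
  · intro T
    let b := (EuclideanSpace.basisFun (Fin n) ℝ).toBasis
    let M := LinearMap.toMatrix b b (T : EuclideanSpace ℝ (Fin n) →ₗ[ℝ] EuclideanSpace ℝ (Fin n))
    let q : Polynomial ℝ := Matrix.det ((Polynomial.X : Polynomial ℝ) • M.map Polynomial.C
      + (1 : Matrix (Fin n) (Fin n) ℝ).map Polynomial.C)
    have hq : ∀ t : ℝ, (ContinuousLinearMap.id ℝ _ + t • T).det = q.eval t := by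
      intro t
      have h1 : (ContinuousLinearMap.id ℝ _ + t • T).det = (1 + t • M).det := by
        rw [ContinuousLinearMap.det, ← LinearMap.det_toMatrix b]
        congr 1
        simp [M]
      rw [h1]
      simp only [q]
      rw [← Polynomial.coe_evalRingHom, RingHom.map_det]
      congr 1
      ext i j
      by_cases hij : i = j <;> simp [hij, add_comm] <;> ring
    have hdeg : q.degree < (Finset.univ : Finset (Fin (n + 1))).card := by
      have := Polynomial.natDegree_det_X_add_C_le M (1 : Matrix (Fin n) (Fin n) ℝ)
      refine lt_of_le_of_lt Polynomial.degree_le_natDegree ?_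
      simp only [Finset.card_univ, Fintype.card_fin] at this ⊢
      exact_mod_cast Nat.lt_succ_of_le this
    have h1 := hq 1
    rw [one_smul] at h1
    rw [h1]
    conv_lhs => rw [Lagrange.eq_interpolate hτ.injOn hdeg, Lagrange.interpolate_apply]
    rw [Polynomial.eval_finsetSum]
    refine Finset.sum_congr rfl fun i _ => ?_
    rw [hq, Polynomial.eval_mul, Polynomial.eval_C, mul_comm]

/-- Extension by zero of a Lipschitz map on a ball, vanishing on the sphere. -/
theorem lip_glue {E : Type*} [NormedAddCommGroup E] [NormedSpace ℝ E] (R : ℝ) (k : E → E)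
    (K : ℝ≥0) (hk : LipschitzOnWith K k (Metric.closedBall 0 R))
    (hb : ∀ x, ‖x‖ = R → k x = 0) (g : E → E)
    (hg1 : ∀ x, ‖x‖ ≤ R → g x = k x) (hg0 : ∀ x, R < ‖x‖ → g x = 0) :
    LipschitzWith K g := by
  have key : ∀ x y, ‖x‖ ≤ R → R < ‖y‖ → dist (g x) (g y) ≤ K * dist x y := by
    intro x y hx hy
    have hc : ContinuousOn (fun s : ℝ => ‖AffineMap.lineMap x y s‖) (Icc 0 1) :=
      (AffineMap.lineMap_continuous.norm).continuousOn
    obtain ⟨s, hs, hsR⟩ := intermediate_value_Icc (zero_le_one) hc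
      (show R ∈ Icc _ _ by simpa using ⟨hx, hy.le⟩)
    set z := AffineMap.lineMap x y s with hz
    simp only at hsR
    have h1 : dist x z ≤ dist x y := by
      rw [hz, dist_left_lineMap, Real.norm_of_nonneg hs.1]
      exact mul_le_of_le_one_left dist_nonneg hs.2
    calc dist (g x) (g y) = dist (k x) (k z) := by rw [hg1 x hx, hg0 y hy, hb z hsR]
      _ ≤ K * dist x z := hk.dist_le_mul x (by simpa using hx) z (by simpa using hsR.le)
      _ ≤ K * dist x y := by gcongr
  refine LipschitzWith.of_dist_le_mul fun x y => ?_
  rcases le_or_gt ‖x‖ R with hx | hx <;> rcases le_or_gt ‖y‖ R with hy | hy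
  · rw [hg1 x hx, hg1 y hy]
    exact hk.dist_le_mul x (by simpa using hx) y (by simpa using hy)
  · exact key x y hx hy
  · rw [dist_comm, dist_comm x y]; exact key y x hy hx
  · rw [hg0 x hx, hg0 y hy, dist_self]; positivity

/-- Perturbing the identity inside a ball by a small multiple of a Lipschitz map maps the ball
bijectively to itself. -/
theorem image_ball {E : Type*} [NormedAddCommGroup E] [NormedSpace ℝ E] [CompleteSpace E]
    (R : ℝ) (g : E → E) (K : ℝ≥0) (hg : LipschitzWith K g) (hg0 : ∀ x, R ≤ ‖x‖ → g x = 0)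
    (t : ℝ) (ht : |t| * K < 1) :
    Function.Injective (fun x => x + t • g x) ∧
      (fun x => x + t • g x) '' Metric.ball 0 R = Metric.ball 0 R := by
  rcases subsingleton_or_nontrivial E with hE | hE
  · refine ⟨fun _ _ _ => Subsingleton.elim _ _, ?_⟩
    have : (fun x : E => x + t • g x) = id := funext fun _ => Subsingleton.elim _ _
    rw [this, image_id]
  have happ : ApproximatesLinearOn (fun x => x + t • g x)
      ((ContinuousLinearEquiv.refl ℝ E : E ≃L[ℝ] E) : E →L[ℝ] E) univ (‖t‖₊ * K) := by
    intro x _ y _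
    have := hg.dist_le_mul x y
    rw [dist_eq_norm, dist_eq_norm] at this
    have e : x + t • g x - (y + t • g y) - (x - y) = t • (g x - g y) := by
      rw [smul_sub]; abel
    simp only [ContinuousLinearEquiv.coe_refl, ContinuousLinearMap.coe_id', id]
    rw [e, norm_smul]
    push_cast
    rw [mul_assoc]
    gcongr
  have hc : ‖t‖₊ * K < ‖((ContinuousLinearEquiv.refl ℝ E).symm : E →L[ℝ] E)‖₊⁻¹ := by
    have : ‖((ContinuousLinearEquiv.refl ℝ E).symm : E →L[ℝ] E)‖₊ = 1 := by
      ext; simp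
    rw [this, inv_one]
    exact_mod_cast ht
  have hinj : Function.Injective (fun x => x + t • g x) :=
    injOn_univ.1 (happ.injOn (Or.inr hc))
  have hsurj := happ.surjective (Or.inr hc)
  refine ⟨hinj, ?_⟩
  have h1 : (fun x => x + t • g x) '' (Metric.ball 0 R)ᶜ = (Metric.ball 0 R)ᶜ := by
    have : EqOn (fun x => x + t • g x) id (Metric.ball 0 R)ᶜ := by
      intro x hx
      have : R ≤ ‖x‖ := by simpa using hx
      simp [hg0 x this]
    rw [this.image_eq, image_id]
  rw [image_compl_eq ⟨hinj, hsurj⟩] at h1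
  exact compl_injective h1

theorem no_retraction_s11 (n : ℕ) (R : ℝ) (hR : 0 < R)
    (ρ : EuclideanSpace ℝ (Fin n) → EuclideanSpace ℝ (Fin n)) (hρ : ContDiff ℝ 1 ρ)
    (hb : ∀ x, ‖x‖ = R → ρ x = x) (hs : ∀ x, ‖ρ x‖ = R) : False := by
  classical
  have hk : ContDiff ℝ 1 (fun x => ρ x - x) := hρ.sub contDiff_id
  obtain ⟨K, hK⟩ := hk.contDiffOn.exists_lipschitzOnWith (s := Metric.closedBall (0 : (EuclideanSpace ℝ (Fin n))) R)
    one_ne_zero (convex_closedBall _ _) (isCompact_closedBall _ _)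
  let g : (EuclideanSpace ℝ (Fin n)) → (EuclideanSpace ℝ (Fin n)) := fun x => if ‖x‖ ≤ R then ρ x - x else 0
  have hgL : LipschitzWith K g := lip_glue R _ K hK (fun x hx => by simp [hb x hx]) g
    (fun x hx => by simp [g, hx]) (fun x hx => by simp [g, not_le.2 hx])
  have hg0 : ∀ x, R ≤ ‖x‖ → g x = 0 := by
    intro x hx
    rcases hx.eq_or_lt with h | h
    · simp [g, h.symm.le, hb x h.symm]
    · simp [g, not_le.2 h]
  let D : (EuclideanSpace ℝ (Fin n)) → ((EuclideanSpace ℝ (Fin n)) →L[ℝ] (EuclideanSpace ℝ (Fin n))) := fun x => fderiv ℝ ρ x - ContinuousLinearMap.id ℝ (EuclideanSpace ℝ (Fin n))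
  have hgD : ∀ x ∈ Metric.ball (0 : (EuclideanSpace ℝ (Fin n))) R, HasFDerivAt g (D x) x := by
    intro x hx
    have h1 : HasFDerivAt (fun x => ρ x - x) (D x) x :=
      ((hρ.differentiable one_ne_zero) x).hasFDerivAt.sub (hasFDerivAt_id x)
    refine h1.congr_of_eventuallyEq ?_
    filter_upwards [Metric.isOpen_ball.mem_nhds hx] with y hy
    have : ‖y‖ ≤ R := by simpa using (Metric.mem_ball.1 hy).le
    simp [g, this]
  have hDK : ∀ x ∈ Metric.ball (0 : (EuclideanSpace ℝ (Fin n))) R, ‖D x‖ ≤ K := fun x hx =>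
    (hgD x hx).le_of_lipschitz hgL
  -- positivity of the determinant near the identity
  obtain ⟨ε, hε, hdet⟩ : ∃ ε > 0, ∀ T : (EuclideanSpace ℝ (Fin n)) →L[ℝ] (EuclideanSpace ℝ (Fin n)), ‖T‖ < ε →
      0 < (ContinuousLinearMap.id ℝ (EuclideanSpace ℝ (Fin n)) + T).det := by
    have hc : ContinuousAt (fun T : (EuclideanSpace ℝ (Fin n)) →L[ℝ] (EuclideanSpace ℝ (Fin n)) => (ContinuousLinearMap.id ℝ (EuclideanSpace ℝ (Fin n)) + T).det) 0 :=
      (ContinuousLinearMap.continuous_det.comp (continuous_const.add continuous_id)).continuousAt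
    have h0 : (0 : ℝ) < (ContinuousLinearMap.id ℝ (EuclideanSpace ℝ (Fin n)) + 0).det := by
      simp [ContinuousLinearMap.det]
    obtain ⟨ε, hε, h⟩ := Metric.eventually_nhds_iff.1 (hc.eventually (lt_mem_nhds h0))
    exact ⟨ε, hε, fun T hT => h (by simpa using hT)⟩
  have hvol : ∀ t : ℝ, |t| * K < 1 → |t| * K < ε →
      IntegrableOn (fun x => (ContinuousLinearMap.id ℝ (EuclideanSpace ℝ (Fin n)) + t • D x).det) (Metric.ball 0 R) ∧
      ∫ x in Metric.ball (0 : (EuclideanSpace ℝ (Fin n))) R, (ContinuousLinearMap.id ℝ (EuclideanSpace ℝ (Fin n)) + t • D x).det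
        = volume.real (Metric.ball (0 : (EuclideanSpace ℝ (Fin n))) R) := by
    intro t ht1 ht2
    obtain ⟨hinj, him⟩ := image_ball R g K hgL hg0 t ht1
    have hd : ∀ x ∈ Metric.ball (0 : (EuclideanSpace ℝ (Fin n))) R, HasFDerivWithinAt (fun x => x + t • g x)
        (ContinuousLinearMap.id ℝ (EuclideanSpace ℝ (Fin n)) + t • D x) (Metric.ball 0 R) x := fun x hx =>
      ((hasFDerivAt_id x).add ((hgD x hx).const_smul t)).hasFDerivWithinAt
    have hpos : EqOn (fun x => |(ContinuousLinearMap.id ℝ (EuclideanSpace ℝ (Fin n)) + t • D x).det| • (1 : ℝ))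
        (fun x => (ContinuousLinearMap.id ℝ (EuclideanSpace ℝ (Fin n)) + t • D x).det) (Metric.ball 0 R) := by
      intro x hx
      have : ‖t • D x‖ < ε := by
        rw [norm_smul]
        refine lt_of_le_of_lt ?_ ht2
        rw [Real.norm_eq_abs]
        gcongr
        exact hDK x hx
      simp [abs_of_pos (hdet _ this)]
    have hI := integrableOn_image_iff_integrableOn_abs_det_fderiv_smul volume
      measurableSet_ball hd hinj.injOn (fun _ => (1 : ℝ))
    have hJ := integral_image_eq_integral_abs_det_fderiv_smul volume
      measurableSet_ball hd hinj.injOn (fun _ => (1 : ℝ))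
    rw [him] at hI hJ
    refine ⟨((hI.1 (integrableOn_const (by simpa using measure_ball_lt_top.ne))).congr_fun
      hpos measurableSet_ball), ?_⟩
    rw [← setIntegral_congr_fun measurableSet_ball hpos, ← hJ]
    simp
  let η : ℝ := min 1 ε / (2 * (K + 1))
  have hmin : 0 < min 1 ε := lt_min one_pos hε
  have hη : 0 < η := by positivity
  have hηK : η * K < min 1 ε := by
    have hK0 : (0 : ℝ) ≤ K := K.2
    rw [div_mul_eq_mul_div, div_lt_iff₀ (by positivity)]
    nlinarith
  let τ : Fin (n + 1) → ℝ := fun i => η / (i + 1)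
  have hτ : Function.Injective τ := by
    intro i j hij
    simp only [τ] at hij
    have hi : (0 : ℝ) < i + 1 := by positivity
    have hj : (0 : ℝ) < j + 1 := by positivity
    rw [div_eq_div_iff hi.ne' hj.ne'] at hij
    have := mul_left_cancel₀ hη.ne' hij
    have h2 : (i : ℝ) = j := by linarith
    exact Fin.ext (by exact_mod_cast h2)
  have hτb : ∀ i, |τ i| * K < min 1 ε := by
    intro i
    have hi : (1 : ℝ) ≤ i + 1 := by simp
    have : |τ i| ≤ η := by
      rw [abs_of_pos (by positivity)]
      exact div_le_self hη.le hi
    refine lt_of_le_of_lt ?_ hηK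
    gcongr
  obtain ⟨c, hc1, hc⟩ := det_interp_s11 n τ hτ
  have hzero : ∀ x, (ContinuousLinearMap.id ℝ (EuclideanSpace ℝ (Fin n)) + D x).det = 0 := by
    intro x
    have e : ContinuousLinearMap.id ℝ (EuclideanSpace ℝ (Fin n)) + D x = fderiv ℝ ρ x := by simp [D]
    rw [e]
    by_contra hne
    have hder := ((hρ.differentiable one_ne_zero) x).hasFDerivAt
    have hsurj : Function.Surjective (fderiv ℝ ρ x) := by
      have hu : IsUnit (fderiv ℝ ρ x : (EuclideanSpace ℝ (Fin n)) →ₗ[ℝ] (EuclideanSpace ℝ (Fin n))) :=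
        (LinearMap.isUnit_iff_isUnit_det _).2 (isUnit_iff_ne_zero.2 hne)
      exact ((Module.End.isUnit_iff _).1 hu).2
    have h2 := (hder.norm_sq).unique
      (show HasFDerivAt (fun x => ‖ρ x‖ ^ 2) (0 : (EuclideanSpace ℝ (Fin n)) →L[ℝ] ℝ) x by
        simpa only [hs] using hasFDerivAt_const (R ^ 2) x)
    obtain ⟨v, hv⟩ := hsurj (ρ x)
    have h3 := congrArg (fun T => T v) h2
    simp [hv, hs, hR.ne'] at h3
  have hfin : volume.real (Metric.ball (0 : (EuclideanSpace ℝ (Fin n))) R) = 0 := by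
    have h1 : ∫ x in Metric.ball (0 : (EuclideanSpace ℝ (Fin n))) R, (ContinuousLinearMap.id ℝ (EuclideanSpace ℝ (Fin n)) + D x).det = 0 := by
      simp [hzero]
    have h2 : ∫ x in Metric.ball (0 : (EuclideanSpace ℝ (Fin n))) R, (ContinuousLinearMap.id ℝ (EuclideanSpace ℝ (Fin n)) + D x).det
        = volume.real (Metric.ball (0 : (EuclideanSpace ℝ (Fin n))) R) := by
      rw [show (fun x => (ContinuousLinearMap.id ℝ (EuclideanSpace ℝ (Fin n)) + D x).det) =
        fun x => ∑ i, c i * (ContinuousLinearMap.id ℝ _ + τ i • D x).det from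
        funext fun x => hc (D x)]
      rw [integral_finsetSum]
      · simp_rw [integral_const_mul]
        rw [Finset.sum_congr rfl fun i _ => by
          rw [(hvol (τ i) ((hτb i).trans_le (min_le_left _ _))
            ((hτb i).trans_le (min_le_right _ _))).2]]
        rw [← Finset.sum_mul, hc1, one_mul]
      · intro i _
        exact ((hvol (τ i) ((hτb i).trans_le (min_le_left _ _))
            ((hτb i).trans_le (min_le_right _ _))).1).const_mul _
    rw [← h2, h1]
  have hpos : 0 < volume (Metric.ball (0 : (EuclideanSpace ℝ (Fin n))) R) := Metric.measure_ball_pos _ _ hR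
  rw [Measure.real, ENNReal.toReal_eq_zero_iff] at hfin
  rcases hfin with h | h
  · exact hpos.ne' h
  · exact measure_ball_lt_top.ne h

theorem surj_euclid (n : ℕ) (F : EuclideanSpace ℝ (Fin n) → EuclideanSpace ℝ (Fin n))
    (hF : Continuous F) (M : ℝ) (hM : ∀ x, ‖F x - x‖ ≤ M) : ∃ x, F x = 0 := by
  by_contra hne
  push Not at hne
  have hM0 : 0 ≤ M := (norm_nonneg _).trans (hM 0)
  obtain ⟨G, hGs, hGd, -⟩ := hF.exists_contDiff_approx 1 (ε := fun x => min ‖F x‖ 1)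
    (by fun_prop) (fun x => lt_min (norm_pos_iff.2 (hne x)) one_pos)
  have hG0 : ∀ x, G x ≠ 0 := by
    intro x hx
    have := (hGd x).trans_le (min_le_left _ _)
    rw [hx, dist_zero_left] at this
    exact lt_irrefl _ this
  have hGM : ∀ x, ‖G x - x‖ ≤ M + 1 := by
    intro x
    have h1 := (hGd x).trans_le (min_le_right _ _)
    rw [dist_eq_norm] at h1
    calc ‖G x - x‖ = ‖(F x - x) + (G x - F x)‖ := by congr 1; abel
      _ ≤ M + 1 := (norm_add_le _ _).trans (add_le_add (hM x) h1.le)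
  let χ : ContDiffBump (0 : EuclideanSpace ℝ (Fin n)) :=
    ⟨M + 2, M + 3, by linarith, by linarith⟩
  let Q : EuclideanSpace ℝ (Fin n) → EuclideanSpace ℝ (Fin n) :=
    fun x => x + χ x • (G x - x)
  have hQs : ContDiff ℝ 1 Q :=
    contDiff_id.add (χ.contDiff.smul (hGs.sub contDiff_id))
  have hQ0 : ∀ x, Q x ≠ 0 := by
    intro x hx
    rcases le_or_gt ‖x‖ (M + 2) with h | h
    · have h1 : χ x = 1 := χ.one_of_mem_closedBall (by simpa [χ] using h)
      simp only [Q, h1, one_smul, add_sub_cancel] at hx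
      exact hG0 x hx
    · have h1 : ‖x‖ = ‖χ x • (G x - x)‖ := by
        have h2 := congrArg norm (eq_neg_of_add_eq_zero_left hx)
        rwa [norm_neg] at h2
      rw [norm_smul, Real.norm_of_nonneg χ.nonneg] at h1
      have : χ x * ‖G x - x‖ ≤ 1 * (M + 1) :=
        mul_le_mul χ.le_one (hGM x) (norm_nonneg _) zero_le_one
      linarith
  have hQb : ∀ x, ‖x‖ = M + 3 → Q x = x := by
    intro x hx
    have : χ x = 0 := χ.zero_of_le_dist (by simp [χ, hx])
    simp [Q, this]
  have hR : 0 < M + 3 := by linarith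
  refine no_retraction_s11 n (M + 3) hR (fun x => ((M + 3) * ‖Q x‖⁻¹) • Q x) ?_ ?_ ?_
  · exact (contDiff_const.mul ((hQs.norm ℝ hQ0).inv fun x => norm_ne_zero_iff.2 (hQ0 x))).smul hQs
  · intro x hx
    simp only [hQb x hx, hx]
    rw [mul_inv_cancel₀ hR.ne', one_smul]
  · intro x
    have := norm_ne_zero_iff.2 (hQ0 x)
    rw [norm_smul, norm_mul, norm_inv, norm_norm, Real.norm_of_nonneg hR.le, mul_assoc,
      inv_mul_cancel₀ this, mul_one]

/-- A continuous self-map of a finite-dimensional space at bounded distance from the identity is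
surjective. -/
theorem surj_of_bounded {V : Type*} [NormedAddCommGroup V] [NormedSpace ℝ V]
    [FiniteDimensional ℝ V] (F : V → V) (hF : Continuous F) (M : ℝ)
    (hM : ∀ x, ‖F x - x‖ ≤ M) : Function.Surjective F := by
  intro y
  let e : V ≃L[ℝ] EuclideanSpace ℝ (Fin (Module.finrank ℝ V)) := toEuclidean
  obtain ⟨z, hz⟩ := surj_euclid _ (fun z => e (F (e.symm z) - y)) (by fun_prop)
    (‖(e : V →L[ℝ] EuclideanSpace ℝ (Fin (Module.finrank ℝ V)))‖ * (M + ‖y‖)) (by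
      intro z
      have h1 : e (F (e.symm z) - y) - z
          = (e : V →L[ℝ] EuclideanSpace ℝ (Fin (Module.finrank ℝ V))) ((F (e.symm z) - e.symm z) - y) := by
        simp only [ContinuousLinearEquiv.coe_coe, map_sub, e.apply_symm_apply]
        try abel
      rw [h1]
      refine (ContinuousLinearMap.le_opNorm _ _).trans ?_
      have h2 : ‖(F (e.symm z) - e.symm z) - y‖ ≤ M + ‖y‖ :=
        (norm_sub_le _ _).trans (add_le_add (hM _) le_rfl)
      exact mul_le_mul_of_nonneg_left h2 (norm_nonneg _))
  refine ⟨e.symm z, ?_⟩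
  have : F (e.symm z) - y = 0 := e.injective (hz.trans (map_zero e).symm)
  exact sub_eq_zero.1 this

theorem one_app_aux {V : Type*} [NormedAddCommGroup V] [NormedSpace ℝ V] (v : V) :
    (1 : V ≃L[ℝ] V) v = v := rfl

theorem hyp_pow {V : Type*} [NormedAddCommGroup V] [NormedSpace ℝ V]
    (B : V ≃L[ℝ] V) (P : V →L[ℝ] V) (a : ℝ) (ha0 : 0 < a)
    (hP : ∀ x, B (P x) = P (B x)) (hc : ∀ x : V, ‖B (P x)‖ ≤ a * ‖P x‖) (n : ℕ) :
    ∀ v, ‖P ((B ^ n) v)‖ ≤ a ^ n * ‖P v‖ := by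
  induction n with
  | zero => intro v; simp [one_app_aux]
  | succ k ih =>
    intro v
    have h1 : (B ^ (k + 1)) v = (B ^ k) (B v) := by rw [pow_succ]; rfl
    rw [h1]
    calc ‖P ((B ^ k) (B v))‖ ≤ a ^ k * ‖P (B v)‖ := ih _
      _ ≤ a ^ k * (a * ‖P v‖) := by rw [← hP]; gcongr; exact hc v
      _ = a ^ (k + 1) * ‖P v‖ := by ring

/-- If moreover `A` preserves a lattice `L`, `G = A + p` with `p` being `L`-periodic, and `H`
is the shadowing semiconjugacy, then `H(x + t) = H(x) + t` for `t ∈ L`; in particular `H`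
descends to a continuous surjection of the torus `V ⧸ L`. -/
theorem semiconjugacy_descends_to_torus
    {V : Type*} [NormedAddCommGroup V] [NormedSpace ℝ V] [FiniteDimensional ℝ V]
    (A : V ≃L[ℝ] V) (Ps Pu : V →L[ℝ] V) (a : ℝ) (ha0 : 0 < a) (ha1 : a < 1)
    (hPs : ∀ x : V, Ps (Ps x) = Ps x) (hPu : ∀ x : V, Pu (Pu x) = Pu x)
    (hsum : ∀ x : V, Ps x + Pu x = x)
    (hAPs : ∀ x : V, A (Ps x) = Ps (A x)) (hAPu : ∀ x : V, A (Pu x) = Pu (A x))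
    (hnorm : ∀ x : V, ‖x‖ = max ‖Ps x‖ ‖Pu x‖)
    (hcontr : ∀ x : V, ‖A (Ps x)‖ ≤ a * ‖Ps x‖)
    (hexpd : ∀ x : V, ‖A.symm (Pu x)‖ ≤ a * ‖Pu x‖)
    (L : AddSubgroup V) (hL : ∀ t ∈ L, A t ∈ L) (hL' : ∀ t ∈ L, A.symm t ∈ L)
    (r : ℝ) (hr : 0 < r) (G : V ≃ₜ V) (hG : ∀ x : V, ‖A x - G x‖ ≤ r)
    (p : V → V) (hGdef : ∀ x : V, G x = A x + p x)
    (hper : ∀ x : V, ∀ t ∈ L, p (x + t) = p x)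
    (H : V → V) (hH : ∀ x : V, ∀ n : ℤ, ‖(A ^ n) (H x) - zIter G n x‖ ≤ r / (1 - a)) :
    (∀ x : V, ∀ t ∈ L, H (x + t) = H x + t) ∧
    ∃ Hbar : V ⧸ L → V ⧸ L, Continuous Hbar ∧ Function.Surjective Hbar ∧
      ∀ x : V, Hbar ((x : V ⧸ L)) = ((H x : V) : V ⧸ L) := by
  have hC : 0 ≤ r / (1 - a) := (norm_nonneg _).trans (hH 0 0)
  set C := r / (1 - a) with hCdef
  -- the hyperbolic estimate
  have hAsPu : ∀ x, A.symm (Pu x) = Pu (A.symm x) := by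
    intro x
    apply A.injective
    rw [A.apply_symm_apply, hAPu, A.apply_symm_apply]
  have hAi : ∀ n : ℕ, A ^ (-(n : ℤ)) = A.symm ^ n := by
    intro n
    rw [zpow_neg, zpow_natCast, ← inv_pow]; rfl
  have hyp : ∀ (N : ℕ) (v : V) (K : ℝ), ‖(A ^ (N : ℤ)) v‖ ≤ K → ‖(A ^ (-(N : ℤ))) v‖ ≤ K →
      ‖v‖ ≤ a ^ N * K := by
    intro N v K h1 h2
    have e1 : (A ^ N) ((A ^ (-(N : ℤ))) v) = v := by
      rw [← zpow_natCast]
      have : (A ^ (N : ℤ) * A ^ (-(N : ℤ))) v = v := by rw [← zpow_add]; simp [one_app_aux]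
      exact this
    have e2 : (A.symm ^ N) ((A ^ (N : ℤ)) v) = v := by
      rw [← hAi]
      have : (A ^ (-(N : ℤ)) * A ^ (N : ℤ)) v = v := by rw [← zpow_add]; simp [one_app_aux]
      exact this
    rw [hnorm v]
    apply max_le
    · have := hyp_pow A Ps a ha0 hAPs hcontr N ((A ^ (-(N : ℤ))) v)
      rw [e1] at this
      refine this.trans ?_
      gcongr
      exact ((le_max_left _ _).trans (hnorm _).ge).trans h2
    · have := hyp_pow A.symm Pu a ha0 hAsPu hexpd N ((A ^ (N : ℤ)) v)
      rw [e2] at this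
      refine this.trans ?_
      gcongr
      exact ((le_max_right _ _).trans (hnorm _).ge).trans h1
  have hlim : ∀ K : ℝ, Tendsto (fun N : ℕ => a ^ N * K) atTop (𝓝 0) := by
    intro K
    simpa using (tendsto_pow_atTop_nhds_zero_of_lt_one ha0.le ha1).mul_const K
  -- equivariance of the iterates
  have hGt : ∀ x, ∀ t ∈ L, G (x + t) = G x + A t := by
    intro x t ht
    rw [hGdef, hGdef, hper x t ht, map_add]; abel
  have hGst : ∀ x, ∀ t ∈ L, G.symm (x + t) = G.symm x + A.symm t := by
    intro x t ht
    apply G.injective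
    rw [G.apply_symm_apply, hGt _ _ (hL' t ht), G.apply_symm_apply, A.apply_symm_apply]
  have hit : ∀ n : ℕ, ∀ x, ∀ t ∈ L, (G : V → V)^[n] (x + t) = (G : V → V)^[n] x + (A ^ n) t := by
    intro n
    induction n with
    | zero => intro x t _; simp [one_app_aux]
    | succ k ih =>
      intro x t ht
      rw [Function.iterate_succ_apply, Function.iterate_succ_apply, hGt x t ht,
        ih _ _ (hL t ht), pow_succ]
      rfl
  have hits : ∀ n : ℕ, ∀ x, ∀ t ∈ L,
      (G.symm : V → V)^[n] (x + t) = (G.symm : V → V)^[n] x + (A.symm ^ n) t := by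
    intro n
    induction n with
    | zero => intro x t _; simp [one_app_aux]
    | succ k ih =>
      intro x t ht
      rw [Function.iterate_succ_apply, Function.iterate_succ_apply, hGst x t ht,
        ih _ _ (hL' t ht), pow_succ]
      rfl
  have hz : ∀ n : ℤ, ∀ x, ∀ t ∈ L, zIter G n (x + t) = zIter G n x + (A ^ n) t := by
    intro n x t ht
    rcases n with n | n
    · simpa [zIter] using hit n x t ht
    · have h := hits (n + 1) x t ht
      rw [← hAi] at h
      simpa only [zIter, Int.negSucc_eq, Nat.cast_add, Nat.cast_one] using h
  have hzc : ∀ n : ℤ, Continuous (zIter G n) := by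
    intro n
    rcases n with n | n
    · exact G.continuous.iterate n
    · exact G.symm.continuous.iterate (n + 1)
  have heq : ∀ x : V, ∀ t ∈ L, H (x + t) = H x + t := by
    intro x t ht
    have hb : ∀ n : ℤ, ‖(A ^ n) (H (x + t) - (H x + t))‖ ≤ C + C := by
      intro n
      have e : (A ^ n) (H (x + t) - (H x + t)) =
          ((A ^ n) (H (x + t)) - zIter G n (x + t)) - ((A ^ n) (H x) - zIter G n x) := by
        rw [hz n x t ht, map_sub, map_add]; abel
      rw [e]
      exact (norm_sub_le _ _).trans (add_le_add (hH _ _) (hH _ _))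
    have h0 : ‖H (x + t) - (H x + t)‖ ≤ 0 :=
      ge_of_tendsto' (hlim (C + C)) fun N => hyp N _ _ (hb _) (hb _)
    exact sub_eq_zero.1 (norm_le_zero_iff.1 h0)
  have hHc : Continuous H := by
    rw [continuous_iff_continuousAt]
    intro x
    rw [ContinuousAt, Metric.tendsto_nhds]
    intro ε hε
    obtain ⟨N, hN⟩ := ((hlim (C + C + 1)).eventually (gt_mem_nhds hε)).exists
    have hev : ∀ n : ℤ, ∀ᶠ y in 𝓝 x, ‖(A ^ n) (H y - H x)‖ ≤ C + C + 1 := by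
      intro n
      filter_upwards [Metric.tendsto_nhds.1 ((hzc n).tendsto x) 1 one_pos] with y hy
      rw [dist_eq_norm] at hy
      have e : (A ^ n) (H y - H x) =
          ((A ^ n) (H y) - zIter G n y) - ((A ^ n) (H x) - zIter G n x)
            + (zIter G n y - zIter G n x) := by
        rw [map_sub]; abel
      rw [e]
      exact (norm_add_le _ _).trans (add_le_add ((norm_sub_le _ _).trans
        (add_le_add (hH _ _) (hH _ _))) hy.le)
    filter_upwards [hev N, hev (-N)] with y h1 h2
    rw [dist_eq_norm]
    exact (hyp N _ _ h1 h2).trans_lt hN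
  have hHs : Function.Surjective H := by
    refine surj_of_bounded H hHc C fun x => ?_
    simpa [zIter, one_app_aux] using hH x 0
  refine ⟨heq, ?_⟩
  have hresp : ∀ x y : V, (x : V ⧸ L) = y → ((H x : V) : V ⧸ L) = (H y : V) := by
    intro x y hxy
    rw [QuotientAddGroup.eq] at hxy ⊢
    have := heq x _ hxy
    rw [add_neg_cancel_left] at this
    rw [this, neg_add_cancel_left]
    exact hxy
  let Hbar : V ⧸ L → V ⧸ L := fun q =>
    Quotient.liftOn' q (fun x => ((H x : V) : V ⧸ L))
      (fun x y hxy => hresp x y (Quotient.sound' hxy))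
  refine ⟨Hbar, ?_, ?_, fun x => rfl⟩
  · exact continuous_quot_lift _ (QuotientAddGroup.continuous_mk.comp hHc)
  · intro q
    obtain ⟨y, rfl⟩ := QuotientAddGroup.mk_surjective q
    obtain ⟨x, rfl⟩ := hHs y
    exact ⟨(x : V ⧸ L), rfl⟩
end
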